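/- arXiv:2408.06311 — 6 statements merged into one kernel-verified Lean document; each statement's English description precedes it below -/
import Mathlib

section
/- Let X be a real m×n matrix, R an invertible real n×n matrix, s > 0 a real number, and E a real n×n matrix such that RᵀR = XᵀX + sI + E and ‖E‖₂ ≤ 0.1·s. Then ‖R⁻¹‖₂ ≤ 1/√(σ_n(X)² + 0.9·s), where σ_n(X) denotes the smallest singular value of X. -/
open scoped BigOperators
open Matrix

/-- `[M]_g`: the largest Euclidean (2-)norm among the columns of `M`. -/
noncomputable def gNorm {m n : ℕ} (M : Matrix (Fin m) (Fin n) ℝ) : ℝ :=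
  ⨆ j : Fin n, Real.sqrt (∑ i, M i j ^ 2)

/-- Spectral norm (largest singular value) of a real matrix. -/
noncomputable def matrixSpectralNorm {m n : ℕ} (A : Matrix (Fin m) (Fin n) ℝ) : ℝ :=
  ‖LinearMap.toContinuousLinearMap (Matrix.toEuclideanLin A)‖

/-- Frobenius norm of a real matrix. -/
noncomputable def frobeniusNorm {m n : ℕ} (A : Matrix (Fin m) (Fin n) ℝ) : ℝ :=
  Real.sqrt (∑ i, ∑ j, A i j ^ 2)

/-- Smallest singular value `σ_n(X)` of a real `m × n` matrix. -/
noncomputable def sigmaMin {m n : ℕ} (X : Matrix (Fin m) (Fin n) ℝ) : ℝ :=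
  ⨅ v : { v : EuclideanSpace ℝ (Fin n) // ‖v‖ = 1 },
    ‖(Matrix.toEuclideanLin X) v.1‖

theorem aux_normsq {m n : ℕ} (A : Matrix (Fin m) (Fin n) ℝ) (v : EuclideanSpace ℝ (Fin n)) :
    ‖Matrix.toEuclideanLin A v‖ ^ 2 = inner ℝ v (Matrix.toEuclideanLin (Aᵀ * A) v) := by
  have h1 : Matrix.toEuclideanLin (Aᵀ * A) v
      = Matrix.toEuclideanLin Aᵀ (Matrix.toEuclideanLin A v) := by
    simp [Matrix.toLpLin_apply, Matrix.mulVec_mulVec]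
  have h2 : Aᵀ = Aᴴ := by ext i j; simp
  rw [h1, h2, Matrix.toEuclideanLin_conjTranspose_eq_adjoint, LinearMap.adjoint_inner_right,
    real_inner_self_eq_norm_sq]

theorem aux_sigma {m n : ℕ} (X : Matrix (Fin m) (Fin n) ℝ) (v : EuclideanSpace ℝ (Fin n)) :
    sigmaMin X * ‖v‖ ≤ ‖Matrix.toEuclideanLin X v‖ := by
  by_cases hv : v = 0
  · simp [hv]
  have hn : 0 < ‖v‖ := norm_pos_iff.mpr hv
  have hu : ‖(‖v‖⁻¹ • v)‖ = 1 := by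
    rw [norm_smul, norm_inv, norm_norm, inv_mul_cancel₀ hn.ne']
  have h1 : sigmaMin X ≤ ‖Matrix.toEuclideanLin X (‖v‖⁻¹ • v)‖ :=
    ciInf_le (f := fun v : { v : EuclideanSpace ℝ (Fin n) // ‖v‖ = 1 } =>
      ‖(Matrix.toEuclideanLin X) v.1‖) ⟨0, by rintro _ ⟨y, rfl⟩; exact norm_nonneg _⟩
      ⟨‖v‖⁻¹ • v, hu⟩
  rw [map_smul, norm_smul, norm_inv, norm_norm, inv_mul_eq_div, le_div_iff₀ hn] at h1
  exact h1

theorem spectralNorm_Rinv_le {m n : ℕ} (X : Matrix (Fin m) (Fin n) ℝ)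
    (R : Matrix (Fin n) (Fin n) ℝ) (hR : IsUnit R.det)
    (s : ℝ) (hs : 0 < s) (E : Matrix (Fin n) (Fin n) ℝ)
    (hE : matrixSpectralNorm E ≤ 0.1 * s)
    (h : Rᵀ * R = Xᵀ * X + s • (1 : Matrix (Fin n) (Fin n) ℝ) + E) :
    matrixSpectralNorm R⁻¹ ≤ 1 / Real.sqrt (sigmaMin X ^ 2 + 0.9 * s) := by
  have hσ : 0 ≤ sigmaMin X := Real.iInf_nonneg fun _ => norm_nonneg _
  have hc : 0 < sigmaMin X ^ 2 + 0.9 * s := by positivity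
  unfold matrixSpectralNorm
  refine ContinuousLinearMap.opNorm_le_bound _ (by positivity) fun w => ?_
  rw [LinearMap.coe_toContinuousLinearMap']
  obtain ⟨v, hv⟩ : ∃ v, v = Matrix.toEuclideanLin R⁻¹ w := ⟨_, rfl⟩
  have hw : w = Matrix.toEuclideanLin R v := by
    rw [hv]
    simp [Matrix.toLpLin_apply, Matrix.mulVec_mulVec, Matrix.mul_nonsing_inv _ hR]
  rw [← hv, hw]
  have hEv : ‖Matrix.toEuclideanLin E v‖ ≤ 0.1 * s * ‖v‖ :=
    (ContinuousLinearMap.le_opNorm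
      (LinearMap.toContinuousLinearMap (Matrix.toEuclideanLin E)) v).trans
      (mul_le_mul_of_nonneg_right hE (norm_nonneg _))
  have hin : -(‖v‖ * (0.1 * s * ‖v‖)) ≤ inner ℝ v (Matrix.toEuclideanLin E v) := by
    have h1 := abs_real_inner_le_norm v (Matrix.toEuclideanLin E v)
    have h2 := mul_le_mul_of_nonneg_left hEv (norm_nonneg v)
    linarith [neg_abs_le (inner ℝ v (Matrix.toEuclideanLin E v))]
  have hX := pow_le_pow_left₀ (by positivity) (aux_sigma X v) 2
  have hone : Matrix.toEuclideanLin (1 : Matrix (Fin n) (Fin n) ℝ) v = v := by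
    simp [Matrix.toLpLin_apply]
  have key := aux_normsq R v
  rw [h, map_add, map_add, map_smul, LinearMap.add_apply, LinearMap.add_apply,
    LinearMap.smul_apply, hone, inner_add_right, inner_add_right, ← aux_normsq,
    inner_smul_right, real_inner_self_eq_norm_sq] at key
  have hfin : (sigmaMin X ^ 2 + 0.9 * s) * ‖v‖ ^ 2 ≤ ‖Matrix.toEuclideanLin R v‖ ^ 2 := by
    rw [key]; nlinarith
  rw [one_div, inv_mul_eq_div, le_div_iff₀ (Real.sqrt_pos.mpr hc)]
  refine (sq_le_sq₀ (by positivity) (norm_nonneg _)).mp ?_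
  rw [mul_pow, Real.sq_sqrt hc.le, mul_comm]
  exact hfin
end

section
/- Let X be a real m×n matrix, R an invertible real n×n matrix, s > 0 a real number, and E a real n×n matrix such that RᵀR = XᵀX + sI + E and ‖E‖₂ ≤ 0.1·s. Then ‖XR⁻¹‖₂ ≤ 1.5. -/
open scoped BigOperators
open Matrix

theorem aux_norm_sq {m n : ℕ} (A : Matrix (Fin m) (Fin n) ℝ) (x : EuclideanSpace ℝ (Fin n)) :
    ‖Matrix.toEuclideanLin A x‖ ^ 2 = x.ofLp ⬝ᵥ ((Aᵀ * A) *ᵥ x.ofLp) := by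
  rw [← Matrix.mulVec_mulVec, Matrix.dotProduct_mulVec, Matrix.vecMul_transpose,
    EuclideanSpace.norm_sq_eq]
  simp [dotProduct, Matrix.toLpLin_apply, sq]

theorem aux_inner {n : ℕ} (E : Matrix (Fin n) (Fin n) ℝ) (x : EuclideanSpace ℝ (Fin n)) :
    - (matrixSpectralNorm E * ‖x‖ ^ 2) ≤ x.ofLp ⬝ᵥ (E *ᵥ x.ofLp) := by
  have h1 : x.ofLp ⬝ᵥ (E *ᵥ x.ofLp) = inner ℝ x (Matrix.toEuclideanLin E x) := by
    simp [dotProduct, PiLp.inner_apply, Matrix.toLpLin_apply, mul_comm]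
  have h2 := (LinearMap.toContinuousLinearMap (Matrix.toEuclideanLin E)).le_opNorm x
  have h3 := abs_real_inner_le_norm x (Matrix.toEuclideanLin E x)
  have h4 := neg_le_of_abs_le h3
  rw [h1]
  change ‖Matrix.toEuclideanLin E x‖ ≤ matrixSpectralNorm E * ‖x‖ at h2
  nlinarith [norm_nonneg x, mul_le_mul_of_nonneg_left h2 (norm_nonneg x)]

theorem spectralNorm_XRinv_le {m n : ℕ} (X : Matrix (Fin m) (Fin n) ℝ)
    (R : Matrix (Fin n) (Fin n) ℝ) (hR : IsUnit R.det)
    (s : ℝ) (hs : 0 < s) (E : Matrix (Fin n) (Fin n) ℝ)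
    (hE : matrixSpectralNorm E ≤ 0.1 * s)
    (h : Rᵀ * R = Xᵀ * X + s • (1 : Matrix (Fin n) (Fin n) ℝ) + E) :
    matrixSpectralNorm (X * R⁻¹) ≤ 1.5 := by
  refine ContinuousLinearMap.opNorm_le_bound _ (by norm_num) fun v => ?_
  change ‖Matrix.toEuclideanLin (X * R⁻¹) v‖ ≤ 1.5 * ‖v‖
  set y : EuclideanSpace ℝ (Fin n) := Matrix.toEuclideanLin R⁻¹ v with hy
  have hX : Matrix.toEuclideanLin (X * R⁻¹) v = Matrix.toEuclideanLin X y := by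
    simp [hy, Matrix.toLpLin_apply, Matrix.mulVec_mulVec]
  have hRy : Matrix.toEuclideanLin R y = v := by
    simp [hy, Matrix.toLpLin_apply, Matrix.mulVec_mulVec, Matrix.mul_nonsing_inv R hR]
  have e1 := aux_norm_sq R y
  have e2 := aux_norm_sq X y
  have e3 := aux_inner E y
  have e4 : y.ofLp ⬝ᵥ y.ofLp = ‖y‖ ^ 2 := by
    rw [EuclideanSpace.norm_sq_eq]
    simp [dotProduct, sq]
  rw [h, Matrix.add_mulVec, Matrix.add_mulVec, dotProduct_add, dotProduct_add, ← e2, hRy,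
    Matrix.smul_mulVec, Matrix.one_mulVec, dotProduct_smul, e4, smul_eq_mul] at e1
  rw [hX]
  have e5 : ‖Matrix.toEuclideanLin X y‖ ^ 2 ≤ ‖v‖ ^ 2 := by
    have := mul_le_mul_of_nonneg_right hE (sq_nonneg ‖y‖)
    have := mul_nonneg hs.le (sq_nonneg ‖y‖)
    linarith
  have e6 := (sq_le_sq₀ (norm_nonneg _) (norm_nonneg v)).1 e5
  linarith [norm_nonneg v]
end

section
/- Let 𝐮 > 0 be a real parameter with n(n+1)𝐮 ≤ 1/64, let m ≥ n ≥ 1, let X be a real m×n matrix with [X]_g > 0, and let s be a real number with s ≥ 11(mn𝐮 + n(n+1)𝐮)[X]_g². Let R be an invertible real n×n matrix with ‖R⁻¹‖₂ ≤ 1/√(σ_n(X)² + 0.9·s). Suppose that for each row index i (1 ≤ i ≤ m) there is a real n×n matrix E_{Ri} with ‖E_{Ri}‖₂ ≤ 1.03·n√n·𝐮·[X]_g such that R + E_{Ri} is invertible, and the i-th row of Q is defined by q_iᵀ = x_iᵀ(R + E_{Ri})⁻¹, where x_iᵀ is the i-th row of X. Then the error matrix E_X := X − QR satisfies ‖E_X‖_F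 ≤ 1.15·n²𝐮·[X]_g² / √(σ_n(X)² + 0.9·s). -/
open scoped BigOperators
open Matrix

lemma aux_vecMul {n : ℕ} (A : Matrix (Fin n) (Fin n) ℝ) (v : Fin n → ℝ) :
    ‖(WithLp.toLp 2 (v ᵥ* A) : EuclideanSpace ℝ (Fin n))‖ ≤
      matrixSpectralNorm A * ‖(WithLp.toLp 2 v : EuclideanSpace ℝ (Fin n))‖ := by
  set w : Fin n → ℝ := v ᵥ* A with hw
  have h1 : ‖(WithLp.toLp 2 w : EuclideanSpace ℝ (Fin n))‖ ^ 2 = v ⬝ᵥ (A *ᵥ w) := by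
    rw [EuclideanSpace.norm_sq_eq, Matrix.dotProduct_mulVec, ← hw]
    simp [dotProduct, sq]
  have h2 : v ⬝ᵥ (A *ᵥ w) = inner ℝ (WithLp.toLp 2 v : EuclideanSpace ℝ (Fin n))
      (LinearMap.toContinuousLinearMap (Matrix.toEuclideanLin A) (WithLp.toLp 2 w)) := by
    simp [PiLp.inner_apply, dotProduct, mul_comm]
  have h3 := real_inner_le_norm (WithLp.toLp 2 v : EuclideanSpace ℝ (Fin n))
      (LinearMap.toContinuousLinearMap (Matrix.toEuclideanLin A) (WithLp.toLp 2 w))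
  have h4 := (LinearMap.toContinuousLinearMap (Matrix.toEuclideanLin A)).le_opNorm
    (WithLp.toLp 2 w)
  have h5 := mul_le_mul_of_nonneg_left h4
    (norm_nonneg (WithLp.toLp 2 v : EuclideanSpace ℝ (Fin n)))
  change _ ≤ _ * (matrixSpectralNorm A * _) at h5
  rcases (norm_nonneg (WithLp.toLp 2 w : EuclideanSpace ℝ (Fin n))).eq_or_lt with h | h
  · rw [← h]
    exact mul_nonneg (norm_nonneg _) (norm_nonneg _)
  · refine le_of_mul_le_mul_right ?_ h
    nlinarith

lemma aux_row {n : ℕ} (R E : Matrix (Fin n) (Fin n) ℝ) (x q : Fin n → ℝ) (D e : ℝ)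
    (hD : 0 < D) (hR : IsUnit R.det) (hRinv : matrixSpectralNorm R⁻¹ ≤ 1 / D)
    (hE : matrixSpectralNorm E ≤ e) (he : e ≤ 0.021 * D)
    (hRE : IsUnit (R + E).det) (hq : q = x ᵥ* (R + E)⁻¹) :
    ∑ j, (x j - (q ᵥ* R) j) ^ 2 ≤ (e / (0.979 * D)) ^ 2 * ∑ j, x j ^ 2 := by
  have h1 : q ᵥ* R + q ᵥ* E = x := by
    rw [← Matrix.vecMul_add, hq, Matrix.vecMul_vecMul, Matrix.nonsing_inv_mul _ hRE,
      Matrix.vecMul_one]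
  have h2 : q = (x - q ᵥ* E) ᵥ* R⁻¹ := by
    rw [← h1, add_sub_cancel_right, Matrix.vecMul_vecMul, Matrix.mul_nonsing_inv _ hR,
      Matrix.vecMul_one]
  have h3 := aux_vecMul R⁻¹ (x - q ᵥ* E)
  rw [← h2, WithLp.toLp_sub] at h3
  have h4 := aux_vecMul E q
  have h5 := norm_sub_le (WithLp.toLp 2 x : EuclideanSpace ℝ (Fin n)) (WithLp.toLp 2 (q ᵥ* E))
  have hE0 : 0 ≤ matrixSpectralNorm E := norm_nonneg _
  have e1 : ∑ j, (x j - (q ᵥ* R) j) ^ 2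
      = ‖(WithLp.toLp 2 (q ᵥ* E) : EuclideanSpace ℝ (Fin n))‖ ^ 2 := by
    rw [EuclideanSpace.norm_sq_eq]
    refine Finset.sum_congr rfl fun j _ => ?_
    rw [← congrFun h1 j]
    simp
  have e2 : ∑ j, x j ^ 2 = ‖(WithLp.toLp 2 x : EuclideanSpace ℝ (Fin n))‖ ^ 2 := by
    rw [EuclideanSpace.norm_sq_eq]; simp
  rw [e1, e2, ← mul_pow]
  have hq0 := norm_nonneg (WithLp.toLp 2 q : EuclideanSpace ℝ (Fin n))
  have hx0 := norm_nonneg (WithLp.toLp 2 x : EuclideanSpace ℝ (Fin n))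
  have hd0 := norm_nonneg ((WithLp.toLp 2 x : EuclideanSpace ℝ (Fin n)) - WithLp.toLp 2 (q ᵥ* E))
  set a := ‖(WithLp.toLp 2 q : EuclideanSpace ℝ (Fin n))‖
  set b := ‖(WithLp.toLp 2 x : EuclideanSpace ℝ (Fin n))‖
  set c := ‖(WithLp.toLp 2 (q ᵥ* E) : EuclideanSpace ℝ (Fin n))‖
  set d := ‖(WithLp.toLp 2 x : EuclideanSpace ℝ (Fin n)) - WithLp.toLp 2 (q ᵥ* E)‖
  have h6 : c ≤ e * a := h4.trans (mul_le_mul_of_nonneg_right hE hq0)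
  have h7 : a * D ≤ d := by
    have : a ≤ 1 / D * d := h3.trans (mul_le_mul_of_nonneg_right hRinv hd0)
    rw [one_div_mul_eq_div, le_div_iff₀ hD] at this
    exact this
  have h8 : e * a ≤ 0.021 * D * a := mul_le_mul_of_nonneg_right he hq0
  have h9 : a ≤ b / (0.979 * D) := by
    rw [le_div_iff₀ (by positivity)]
    nlinarith
  refine pow_le_pow_left₀ (norm_nonneg _) ?_ 2
  calc c ≤ e * a := h6
    _ ≤ e * (b / (0.979 * D)) := mul_le_mul_of_nonneg_left h9 (hE0.trans hE)
    _ = _ := by ring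

lemma aux_frob {m n : ℕ} (X : Matrix (Fin m) (Fin n) ℝ) :
    ∑ i, ∑ j, X i j ^ 2 ≤ n * gNorm X ^ 2 := by
  rw [Finset.sum_comm]
  have : ∀ j ∈ (Finset.univ : Finset (Fin n)), ∑ i, X i j ^ 2 ≤ gNorm X ^ 2 := by
    intro j _
    have h0 : 0 ≤ ∑ i, X i j ^ 2 := Finset.sum_nonneg fun i _ => sq_nonneg _
    have h := le_ciSup (f := fun j : Fin n => Real.sqrt (∑ i, X i j ^ 2))
      (Set.finite_range _).bddAbove j
    calc _ = Real.sqrt (∑ i, X i j ^ 2) ^ 2 := (Real.sq_sqrt h0).symm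
      _ ≤ _ := pow_le_pow_left₀ (Real.sqrt_nonneg _) h 2
  simpa using Finset.sum_le_sum this

theorem frobeniusNorm_EX_le {m n : ℕ} (u : ℝ) (hu : 0 < u)
    (hnnu : (n : ℝ) * (n + 1) * u ≤ 1 / 64) (hmn : n ≤ m) (hn : 1 ≤ n)
    (X : Matrix (Fin m) (Fin n) ℝ) (hX : 0 < gNorm X)
    (s : ℝ)
    (hs : 11 * ((m : ℝ) * n * u + (n : ℝ) * (n + 1) * u) * gNorm X ^ 2 ≤ s)
    (R : Matrix (Fin n) (Fin n) ℝ) (hR : IsUnit R.det)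
    (hRinv : matrixSpectralNorm R⁻¹ ≤ 1 / Real.sqrt (sigmaMin X ^ 2 + 0.9 * s))
    (Q : Matrix (Fin m) (Fin n) ℝ)
    (hQ : ∀ i : Fin m, ∃ ERi : Matrix (Fin n) (Fin n) ℝ,
      matrixSpectralNorm ERi ≤ 1.03 * (n : ℝ) * Real.sqrt n * u * gNorm X ∧
      IsUnit (R + ERi).det ∧ Q i = X i ᵥ* (R + ERi)⁻¹) :
    frobeniusNorm (X - Q * R) ≤
      1.15 * (n : ℝ) ^ 2 * u * gNorm X ^ 2 /
        Real.sqrt (sigmaMin X ^ 2 + 0.9 * s) := by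
  set g := gNorm X with hg
  set D := Real.sqrt (sigmaMin X ^ 2 + 0.9 * s) with hDdef
  set e := 1.03 * (n : ℝ) * Real.sqrt n * u * g with hedef
  have hn1 : (1 : ℝ) ≤ n := by exact_mod_cast hn
  have hmn1 : (n : ℝ) ≤ m := by exact_mod_cast hmn
  have hsn : Real.sqrt n ^ 2 = n := Real.sq_sqrt (by positivity)
  have he0 : 0 ≤ e := by positivity
  have hs2 : 22 * (n : ℝ) ^ 2 * u * g ^ 2 ≤ s := by
    refine le_trans ?_ hs
    have : 22 * (n : ℝ) ^ 2 * u ≤ 11 * ((m : ℝ) * n * u + (n : ℝ) * (n + 1) * u) := by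
      have h1 : (n : ℝ) * (n * u) ≤ m * (n * u) :=
        mul_le_mul_of_nonneg_right hmn1 (by positivity)
      have h2 : 0 < (n : ℝ) * u := by positivity
      nlinarith
    exact mul_le_mul_of_nonneg_right this (by positivity)
  have hs0 : 0 < s := lt_of_lt_of_le (by positivity) hs2
  have hD : 0 < D := Real.sqrt_pos.mpr (by positivity)
  have hD2 : D ^ 2 = sigmaMin X ^ 2 + 0.9 * s := Real.sq_sqrt (by positivity)
  have hnu : (n : ℝ) * u ≤ 1 / 128 := by
    have h2 : 0 < (n : ℝ) * u := by positivity
    nlinarith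
  have he : e ≤ 0.021 * D := by
    refine (sq_le_sq₀ he0 (by positivity)).mp ?_
    have e1 : e ^ 2 = 1.0609 * (n * u) * (n ^ 2 * u * g ^ 2) := by
      rw [hedef, mul_pow, mul_pow, mul_pow, hsn]; ring
    rw [e1, mul_pow, hD2]
    have h3 : 0 ≤ (n : ℝ) ^ 2 * u * g ^ 2 := by positivity
    have h4 := mul_le_mul_of_nonneg_right hnu h3
    nlinarith [sq_nonneg (sigmaMin X)]
  have hrow : ∀ i ∈ (Finset.univ : Finset (Fin m)),
      ∑ j, (X - Q * R) i j ^ 2 ≤ (e / (0.979 * D)) ^ 2 * ∑ j, X i j ^ 2 := by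
    intro i _
    obtain ⟨E, hE, hRE, hq⟩ := hQ i
    exact aux_row R E (X i) (Q i) D e hD hR hRinv hE he hRE hq
  have hsum := Finset.sum_le_sum hrow
  rw [← Finset.mul_sum] at hsum
  have hfin := hsum.trans (mul_le_mul_of_nonneg_left (aux_frob X) (sq_nonneg _))
  unfold frobeniusNorm
  refine Real.sqrt_le_iff.mpr ⟨by positivity, hfin.trans ?_⟩
  have e2 : (e / (0.979 * D)) ^ 2 * (n * gNorm X ^ 2)
      = (1.03 / 0.979 * (n : ℝ) ^ 2 * u * g ^ 2 / D) ^ 2 := by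
    rw [← hg, div_pow, hedef, mul_pow, mul_pow, mul_pow, hsn]
    field_simp
  rw [e2]
  refine pow_le_pow_left₀ (by positivity) ?_ 2
  gcongr
  norm_num
end

section
/- Let 𝐮 > 0 be a real parameter, let m ≥ n ≥ 1, and let X be a real m×n matrix. Let s > 0 satisfy s ≥ 11(mn𝐮 + n(n+1)𝐮)[X]_g², let R be an invertible real n×n matrix and E a real n×n matrix such that RᵀR = XᵀX + sI + E with ‖E‖₂ ≤ 0.1·s. Let Q := (X + E_X)R⁻¹ where E_X is a real m×n matrix with ‖E_X‖₂ ≤ 1.15·n²𝐮·[X]_g² / √(σ_n(X)² + 0.9·s). Then ‖QᵀQ − I‖₂ ≤ 1.6. -/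
open scoped BigOperators
open Matrix

lemma aux_mul {a b c : ℕ} (A : Matrix (Fin a) (Fin b) ℝ) (B : Matrix (Fin b) (Fin c) ℝ)
    (x : EuclideanSpace ℝ (Fin c)) :
    Matrix.toEuclideanLin (A * B) x = Matrix.toEuclideanLin A (Matrix.toEuclideanLin B x) := by
  simp [Matrix.toLpLin_apply, Matrix.mulVec_mulVec]

lemma aux_one {a : ℕ} (x : EuclideanSpace ℝ (Fin a)) :
    Matrix.toEuclideanLin (1 : Matrix (Fin a) (Fin a) ℝ) x = x := by
  simp [Matrix.toLpLin_apply]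

lemma aux_inner_s11 {a b : ℕ} (A : Matrix (Fin a) (Fin b) ℝ)
    (x : EuclideanSpace ℝ (Fin a)) (y : EuclideanSpace ℝ (Fin b)) :
    inner ℝ (Matrix.toEuclideanLin Aᵀ x) y = inner ℝ x (Matrix.toEuclideanLin A y) := by
  rw [← Matrix.conjTranspose_eq_transpose_of_trivial, Matrix.toEuclideanLin_conjTranspose_eq_adjoint,
    LinearMap.adjoint_inner_left]

lemma aux_le {a b : ℕ} (A : Matrix (Fin a) (Fin b) ℝ) (x : EuclideanSpace ℝ (Fin b)) :
    ‖Matrix.toEuclideanLin A x‖ ≤ matrixSpectralNorm A * ‖x‖ :=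
  (LinearMap.toContinuousLinearMap (Matrix.toEuclideanLin A)).le_opNorm x

lemma aux_gram {a b : ℕ} (Q : Matrix (Fin a) (Fin b) ℝ) (k : ℝ) (hk : 0 ≤ k) (hk2 : k ^ 2 ≤ 2)
    (h : ∀ v, ‖Matrix.toEuclideanLin Q v‖ ≤ k * ‖v‖) :
    matrixSpectralNorm (Qᵀ * Q - 1) ≤ 1 := by
  refine ContinuousLinearMap.opNorm_le_bound _ zero_le_one fun v => ?_
  change ‖Matrix.toEuclideanLin (Qᵀ * Q - 1) v‖ ≤ _
  rw [map_sub, LinearMap.sub_apply, aux_one, aux_mul]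
  set q := Matrix.toEuclideanLin Q v with hq
  set p := Matrix.toEuclideanLin Qᵀ q with hp
  have h1 : ‖p - v‖ ^ 2 = ‖p‖ ^ 2 - 2 * ‖q‖ ^ 2 + ‖v‖ ^ 2 := by
    rw [norm_sub_sq_real, hp, aux_inner_s11, ← hq, real_inner_self_eq_norm_sq]
  have h2 : ‖p‖ ^ 2 ≤ ‖q‖ * (k * ‖p‖) := by
    rw [← real_inner_self_eq_norm_sq]
    nth_rewrite 1 [hp]
    rw [aux_inner_s11]
    exact (real_inner_le_norm _ _).trans (by gcongr; exact h p)
  have h3 : ‖p‖ ≤ k * ‖q‖ := by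
    rcases eq_or_lt_of_le (norm_nonneg p) with h0 | h0
    · rw [← h0]; positivity
    · nlinarith
  have h4 : ‖p‖ ^ 2 ≤ 2 * ‖q‖ ^ 2 := by
    calc ‖p‖ ^ 2 ≤ (k * ‖q‖) ^ 2 := by gcongr
      _ = k ^ 2 * ‖q‖ ^ 2 := by ring
      _ ≤ _ := by gcongr
  rw [one_mul]
  exact abs_le_of_sq_le_sq' (by linarith) (norm_nonneg v) |>.2

theorem orthogonality_ISCholeskyQR {m n : ℕ} (u : ℝ) (hu : 0 < u)
    (hmn : n ≤ m) (hn : 1 ≤ n)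
    (X : Matrix (Fin m) (Fin n) ℝ)
    (s : ℝ) (hs : 0 < s)
    (hs' : 11 * ((m : ℝ) * n * u + (n : ℝ) * (n + 1) * u) * gNorm X ^ 2 ≤ s)
    (R : Matrix (Fin n) (Fin n) ℝ) (hR : IsUnit R.det)
    (E : Matrix (Fin n) (Fin n) ℝ)
    (hRE : Rᵀ * R = Xᵀ * X + s • (1 : Matrix (Fin n) (Fin n) ℝ) + E)
    (hE : matrixSpectralNorm E ≤ 0.1 * s)
    (EX : Matrix (Fin m) (Fin n) ℝ)
    (hEX : matrixSpectralNorm EX ≤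
      1.15 * (n : ℝ) ^ 2 * u * gNorm X ^ 2 /
        Real.sqrt (sigmaMin X ^ 2 + 0.9 * s)) :
    matrixSpectralNorm
      (((X + EX) * R⁻¹)ᵀ * ((X + EX) * R⁻¹) -
        (1 : Matrix (Fin n) (Fin n) ℝ)) ≤ 1.6 := by
  have hg : (n : ℝ) ^ 2 * u * gNorm X ^ 2 ≤ s / 22 := by
    have hmn' : (n : ℝ) ≤ m := by exact_mod_cast hmn
    have h0 : (0 : ℝ) ≤ n := by positivity
    have : 22 * ((n : ℝ) ^ 2 * u) ≤ 11 * ((m : ℝ) * n * u + (n : ℝ) * (n + 1) * u) := by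
      have h1 : (n : ℝ) * n * u ≤ m * n * u := by gcongr
      have h2 : 0 ≤ (n : ℝ) * u := by positivity
      nlinarith
    have := mul_le_mul_of_nonneg_right this (sq_nonneg (gNorm X))
    linarith
  set t := Real.sqrt s with ht
  have htp : 0 < t := Real.sqrt_pos.2 hs
  have hts : t ^ 2 = s := Real.sq_sqrt hs.le
  have hd : 0.94 * t ≤ Real.sqrt (sigmaMin X ^ 2 + 0.9 * s) := by
    apply Real.le_sqrt_of_sq_le
    nlinarith [sq_nonneg (sigmaMin X)]
  have hEX' : matrixSpectralNorm EX ≤ 0.056 * t := by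
    refine hEX.trans ?_
    rw [div_le_iff₀ (by linarith)]
    nlinarith
  refine (aux_gram _ 1.1 (by norm_num) (by norm_num) fun v => ?_).trans (by norm_num)
  rw [aux_mul, map_add, LinearMap.add_apply]
  set w := Matrix.toEuclideanLin R⁻¹ v with hw
  have hRw : Matrix.toEuclideanLin R w = v := by
    rw [hw, ← aux_mul, Matrix.mul_nonsing_inv _ hR, aux_one]
  have key : ‖v‖ ^ 2 = ‖Matrix.toEuclideanLin X w‖ ^ 2 + s * ‖w‖ ^ 2
      + inner ℝ (Matrix.toEuclideanLin E w) w := by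
    have h := congrArg (fun M => inner ℝ (Matrix.toEuclideanLin M w) w) hRE
    simp only [map_add, map_smul, LinearMap.add_apply, LinearMap.smul_apply, inner_add_left,
      aux_mul, aux_one, aux_inner_s11, inner_smul_left, hRw, real_inner_self_eq_norm_sq] at h
    simpa using h
  have hEw : -(0.1 * s * ‖w‖ ^ 2) ≤ inner ℝ (Matrix.toEuclideanLin E w) w := by
    have h1 := abs_real_inner_le_norm (Matrix.toEuclideanLin E w) w
    have h2 := (aux_le E w).trans (mul_le_mul_of_nonneg_right hE (norm_nonneg w))
    have h3 := mul_le_mul_of_nonneg_right h2 (norm_nonneg w)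
    have h4 := (abs_le.1 h1).1
    nlinarith
  have hX : ‖Matrix.toEuclideanLin X w‖ ≤ ‖v‖ := by
    refine abs_le_of_sq_le_sq' ?_ (norm_nonneg v) |>.2
    nlinarith [mul_nonneg hs.le (sq_nonneg ‖w‖)]
  have htw : 0.9 * (t * ‖w‖) ≤ ‖v‖ := by
    refine abs_le_of_sq_le_sq' ?_ (norm_nonneg v) |>.2
    have : (0.9 * (t * ‖w‖)) ^ 2 = 0.81 * (s * ‖w‖ ^ 2) := by rw [← hts]; ring
    rw [this]
    nlinarith [mul_nonneg hs.le (sq_nonneg ‖w‖), sq_nonneg ‖Matrix.toEuclideanLin X w‖]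
  have hEXw := (aux_le EX w).trans (mul_le_mul_of_nonneg_right hEX' (norm_nonneg w))
  have := norm_add_le (Matrix.toEuclideanLin X w) (Matrix.toEuclideanLin EX w)
  have := norm_nonneg v
  nlinarith
end

section
/- Let 𝐮 > 0 be a real parameter, let m ≥ n ≥ 1, and let X, Q be real m×n matrices and R a real n×n matrix. Suppose ‖Q‖₂ ≤ 1.62, and suppose that for each row index i (1 ≤ i ≤ m) there is a real n×n matrix E_{Ri} with ‖E_{Ri}‖₂ ≤ 1.03·n√n·𝐮·[X]_g such that the i-th row of X satisfies x_iᵀ = q_iᵀ(R + E_{Ri}), where q_iᵀ is the i-th row of Q. Then ‖QR − X‖_F ≤ 1.67·n²𝐮·[X]_g. -/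
open scoped BigOperators
open Matrix

open scoped Matrix.Norms.L2Operator in
lemma spec_eq {m n : ℕ} (A : Matrix (Fin m) (Fin n) ℝ) : matrixSpectralNorm A = ‖A‖ := by
  rw [Matrix.l2_opNorm_def]; rfl

open scoped Matrix.Norms.L2Operator in
lemma spec_transpose {m n : ℕ} (A : Matrix (Fin m) (Fin n) ℝ) :
    matrixSpectralNorm Aᵀ = matrixSpectralNorm A := by
  rw [spec_eq, spec_eq, ← Matrix.conjTranspose_eq_transpose_of_trivial,
    Matrix.l2_opNorm_conjTranspose]

lemma spec_mulVec {m n : ℕ} (A : Matrix (Fin m) (Fin n) ℝ) (c : ℝ)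
    (hA : matrixSpectralNorm A ≤ c) (v : Fin n → ℝ) :
    ∑ i, (A *ᵥ v) i ^ 2 ≤ c ^ 2 * ∑ j, v j ^ 2 := by
  have h := (LinearMap.toContinuousLinearMap (Matrix.toEuclideanLin A)).le_of_opNorm_le hA
    (WithLp.toLp 2 v)
  have h2 := pow_le_pow_left₀ (norm_nonneg _) h 2
  rw [mul_pow, EuclideanSpace.norm_sq_eq, EuclideanSpace.norm_sq_eq] at h2
  simpa [Matrix.toLpLin_toLp] using h2

lemma spec_frob {m n : ℕ} (A : Matrix (Fin m) (Fin n) ℝ) (c : ℝ)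
    (hA : matrixSpectralNorm A ≤ c) :
    ∑ i, ∑ j, A i j ^ 2 ≤ n * c ^ 2 := by
  rw [Finset.sum_comm]
  calc ∑ j, ∑ i, A i j ^ 2 ≤ ∑ j : Fin n, c ^ 2 := by
        refine Finset.sum_le_sum fun j _ => ?_
        have := spec_mulVec A c hA (Pi.single j 1)
        simpa [Pi.single_apply, ite_pow] using this
    _ = n * c ^ 2 := by simp

theorem residual_ISCholeskyQR {m n : ℕ} (u : ℝ) (hu : 0 < u)
    (hmn : n ≤ m) (hn : 1 ≤ n)
    (X Q : Matrix (Fin m) (Fin n) ℝ) (R : Matrix (Fin n) (Fin n) ℝ)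
    (hQ : matrixSpectralNorm Q ≤ 1.62)
    (h : ∀ i : Fin m, ∃ ERi : Matrix (Fin n) (Fin n) ℝ,
      matrixSpectralNorm ERi ≤ 1.03 * (n : ℝ) * Real.sqrt n * u * gNorm X ∧
      X i = Q i ᵥ* (R + ERi)) :
    frobeniusNorm (Q * R - X) ≤ 1.67 * (n : ℝ) ^ 2 * u * gNorm X := by
  have hg : 0 ≤ gNorm X := Real.iSup_nonneg fun j => Real.sqrt_nonneg _
  set c : ℝ := 1.03 * (n : ℝ) * Real.sqrt n * u * gNorm X with hc
  have hrow : ∀ i, ∑ j, (Q * R - X) i j ^ 2 ≤ c ^ 2 * ∑ j, Q i j ^ 2 := by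
    intro i
    obtain ⟨E, hE, hX⟩ := h i
    rw [← spec_transpose] at hE
    have h1 := spec_mulVec Eᵀ c hE (Q i)
    rw [Matrix.mulVec_transpose] at h1
    refine le_trans (le_of_eq ?_) h1
    refine Finset.sum_congr rfl fun j _ => ?_
    have h2 : (Q * R) i j = (Q i ᵥ* R) j := rfl
    rw [Matrix.sub_apply, hX, Matrix.vecMul_add, Pi.add_apply, h2]
    ring
  have hF := spec_frob Q 1.62 hQ
  have hs : Real.sqrt n ^ 2 = n := Real.sq_sqrt (Nat.cast_nonneg n)
  unfold frobeniusNorm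
  apply Real.sqrt_le_iff.mpr
  refine ⟨by positivity, ?_⟩
  calc ∑ i, ∑ j, (Q * R - X) i j ^ 2 ≤ ∑ i, c ^ 2 * ∑ j, Q i j ^ 2 :=
        Finset.sum_le_sum fun i _ => hrow i
    _ = c ^ 2 * ∑ i, ∑ j, Q i j ^ 2 := by rw [Finset.mul_sum]
    _ ≤ c ^ 2 * (n * 1.62 ^ 2) := by gcongr
    _ = (1.03 * 1.62) ^ 2 * ((n : ℝ) ^ 2 * u * gNorm X) ^ 2 := by
        rw [hc, mul_pow, mul_pow, mul_pow, mul_pow, hs]; ring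
    _ ≤ 1.67 ^ 2 * ((n : ℝ) ^ 2 * u * gNorm X) ^ 2 := by
        gcongr; norm_num
    _ = _ := by ring
end

section
/- Let X be a real m×n matrix, R a real n×n matrix, s ≥ 0 a real number with s ≤ [X]_g²/100, and E a real n×n matrix such that RᵀR = XᵀX + sI + E and ‖E‖₂ ≤ 0.1·s. Then [R]_g ≤ 1.006·[X]_g. -/
open scoped BigOperators
open Matrix

theorem gNorm_R_le {m n : ℕ} (X : Matrix (Fin m) (Fin n) ℝ)
    (R : Matrix (Fin n) (Fin n) ℝ) (s : ℝ) (hs : 0 ≤ s)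
    (hs' : s ≤ gNorm X ^ 2 / 100)
    (E : Matrix (Fin n) (Fin n) ℝ) (hE : matrixSpectralNorm E ≤ 0.1 * s)
    (h : Rᵀ * R = Xᵀ * X + s • (1 : Matrix (Fin n) (Fin n) ℝ) + E) :
    gNorm R ≤ 1.006 * gNorm X := by
  have hg0 : 0 ≤ gNorm X := Real.iSup_nonneg fun j => Real.sqrt_nonneg _
  refine Real.iSup_le (fun j => ?_) (by positivity)
  have hX : Real.sqrt (∑ i, X i j ^ 2) ≤ gNorm X :=
    le_ciSup (f := fun j : Fin n => Real.sqrt (∑ i, X i j ^ 2)) (Set.finite_range _).bddAbove j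
  have hX2 : ∑ i, X i j ^ 2 ≤ gNorm X ^ 2 := (Real.sqrt_le_left hg0).1 hX
  have hEj : E j j ≤ 0.1 * s := by
    have h1 := (LinearMap.toContinuousLinearMap (Matrix.toEuclideanLin E)).le_opNorm
      (EuclideanSpace.single j (1 : ℝ))
    have h2 := PiLp.norm_apply_le ((LinearMap.toContinuousLinearMap (Matrix.toEuclideanLin E))
      (EuclideanSpace.single j (1 : ℝ))) j
    have h3 : ((LinearMap.toContinuousLinearMap (Matrix.toEuclideanLin E))
      (EuclideanSpace.single j (1 : ℝ))) j = E j j := by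
      simp [Matrix.toLpLin_apply]
    rw [h3] at h2
    have h4 : ‖(EuclideanSpace.single j (1 : ℝ))‖ = 1 := by simp
    rw [h4, mul_one] at h1
    exact (Real.le_norm_self _).trans (h2.trans (h1.trans hE))
  have hj := congrFun (congrFun h j) j
  simp only [Matrix.add_apply, Matrix.mul_apply, Matrix.transpose_apply, Matrix.smul_apply,
    Matrix.one_apply_eq, smul_eq_mul, mul_one, ← pow_two] at hj
  apply Real.sqrt_le_iff.2
  refine ⟨by positivity, ?_⟩
  rw [hj]
  nlinarith [sq_nonneg (gNorm X)]
end
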